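/- Let ξ ∈ ℝ with −α < ξ < 0, and let u ∈ C²([0,R)) with u(0) = ξ and u'(0) = 0 be the solution of the radial Pucci equation for M⁺ on its maximal interval of existence [0,R). Then R = +∞, u is oscillating (it has an unbounded sequence of zeros), u is localized (u(r), u'(r), u''(r) → 0 as r → +∞), and sup_{r ≥ 0} |u(r)| = −ξ < α. -/

import Mathlib

open Set Filter Topology

/-- The coefficient of the Pucci operator `M⁺` selected by the sign of `x`. -/
noncomputable def pucciWeight (lam Lam x : ℝ) : ℝ := if 0 ≤ x then Lam else lam

/-- `u` is a radial solution on `I`, with first and second derivatives `p` and `q`; the real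
parameter `n` is the dimension minus one. -/
structure IsRadialSol (lam Lam n : ℝ) (g u p q : ℝ → ℝ) (I : Set ℝ) : Prop where
  deriv_fst : ∀ r ∈ I, HasDerivAt u (p r) r
  deriv_snd : ∀ r ∈ I, HasDerivAt p (q r) r
  eqn : ∀ r ∈ I, pucciWeight lam Lam (q r) * q r
    + n / r * (pucciWeight lam Lam (p r) * p r) + g (u r) = 0

/-- The force per unit weight whose primitive is the potential energy. -/
noncomputable def pucciForce (lam Lam : ℝ) (g : ℝ → ℝ) (s : ℝ) : ℝ :=
  if 0 ≤ s then g s / lam else g s / Lam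

/-- The potential energy. -/
noncomputable def pucciPotential (lam Lam : ℝ) (g : ℝ → ℝ) (t : ℝ) : ℝ :=
  ∫ s in (0 : ℝ)..t, pucciForce lam Lam g s

section Pointwise

variable {lam Lam : ℝ}

lemma le_pucciWeight (h : lam ≤ Lam) (x : ℝ) : lam ≤ pucciWeight lam Lam x := by
  unfold pucciWeight; split_ifs <;> linarith

lemma pucciWeight_le (h : lam ≤ Lam) (x : ℝ) : pucciWeight lam Lam x ≤ Lam := by
  unfold pucciWeight; split_ifs <;> linarith

lemma pucciWeight_pos (hlam : 0 < lam) (h : lam ≤ Lam) (x : ℝ) : 0 < pucciWeight lam Lam x :=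
  hlam.trans_le (le_pucciWeight h x)

lemma pucciWeight_mul_self (h : lam ≤ Lam) (x : ℝ) :
    pucciWeight lam Lam x * x = max (Lam * x) (lam * x) := by
  unfold pucciWeight
  split_ifs with hx
  · rw [max_eq_left (by nlinarith)]
  · rw [max_eq_right (by nlinarith)]

/-- Dissipation inequality for the energy. -/
lemma dissipation (hlam : 0 < lam) (h : lam ≤ Lam) {D p q x y : ℝ} (hD : 0 ≤ D)
    (hpos : 0 ≤ x → 0 ≤ y) (hneg : x < 0 → y ≤ 0)
    (heq : pucciWeight lam Lam q * q + D * (pucciWeight lam Lam p * p) + y = 0) :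
    p * (q + (if 0 ≤ x then y / lam else y / Lam)) ≤ -(D * (lam / Lam)) * p ^ 2 := by
  have hLam : 0 < Lam := hlam.trans_le h
  have key : ∀ c, lam ≤ c → c ≤ Lam →
      0 ≤ p * (pucciWeight lam Lam q * q - c * q) + D * (pucciWeight lam Lam p * p ^ 2)
        - c * (D * (lam / Lam)) * p ^ 2 → p * (q + y / c) ≤ -(D * (lam / Lam)) * p ^ 2 := by
    intro c h1 h2 h3
    have hc : 0 < c := by linarith
    rw [← mul_le_mul_iff_right₀ hc]
    have e1 : c * (p * (q + y / c)) = p * (c * q + y) := by field_simp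
    have e2 : y = -(pucciWeight lam Lam q * q + D * (pucciWeight lam Lam p * p)) := by linarith
    rw [e1, e2]; nlinarith
  have hk : lam / Lam ≤ 1 := (div_le_one hLam).2 h
  have hk0 : 0 < lam / Lam := div_pos hlam hLam
  have hkL : Lam * (lam / Lam) = lam := by field_simp
  have hDp : 0 ≤ D * p ^ 2 := by positivity
  rcases le_or_gt 0 p with hp | hp
  · have hw : pucciWeight lam Lam p = Lam := by simp [pucciWeight, hp]
    have main : ∀ c, lam ≤ c → c ≤ Lam → p * (q + y / c) ≤ -(D * (lam / Lam)) * p ^ 2 := by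
      intro c h1 h2
      refine key c h1 h2 ?_
      have : c * q ≤ pucciWeight lam Lam q * q := by
        unfold pucciWeight; split_ifs <;> nlinarith
      rw [hw]
      have h4 : c * (lam / Lam) ≤ Lam := by nlinarith
      nlinarith [mul_nonneg hp (sub_nonneg.2 this), mul_le_mul_of_nonneg_right h4 hDp]
    split_ifs
    · exact main lam le_rfl h
    · exact main Lam h le_rfl
  · have hw : pucciWeight lam Lam p = lam := by simp [pucciWeight, not_le.2 hp]
    rw [hw] at heq
    split_ifs with hx
    · rcases le_or_gt 0 q with hq | hq
      · rw [pucciWeight, if_pos hq] at heq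
        have hy := hpos hx
        have e : D * (lam / Lam) * (-p) = q + y / Lam := by
          field_simp; linarith
        have : y / Lam ≤ y / lam := div_le_div_of_nonneg_left hy hlam h
        nlinarith
      · refine key lam le_rfl h ?_
        rw [hw, pucciWeight, if_neg (not_le.2 hq)]
        nlinarith [mul_le_mul_of_nonneg_right hk (mul_nonneg hlam.le hDp)]
    · have hy := hneg (not_le.1 hx)
      have hq : 0 ≤ q := by
        by_contra hq
        rw [pucciWeight, if_neg hq] at heq
        nlinarith [mul_nonneg hD (mul_nonneg hlam.le (neg_nonneg.2 hp.le)),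
          mul_pos hlam (neg_pos.2 (not_le.1 hq))]
      refine key Lam h le_rfl ?_
      rw [hw, pucciWeight, if_pos hq]
      have : Lam * (D * (lam / Lam)) = D * lam := by field_simp
      rw [this]; nlinarith

/-- Bound on `x * q` that uses only the sign condition on the source term. -/
lemma mul_second_deriv_le (hlam : 0 < lam) (h : lam ≤ Lam) {D p q x y : ℝ} (hD : 0 ≤ D)
    (hxy : 0 ≤ x * y)
    (heq : pucciWeight lam Lam q * q + D * (pucciWeight lam Lam p * p) + y = 0) :
    x * q ≤ -(x * y / Lam) + D * (Lam / lam) * |x * p| := by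
  have hLam : 0 < Lam := hlam.trans_le h
  set θ := pucciWeight lam Lam q with hθ
  have h1 : lam ≤ θ := le_pucciWeight h q
  have h2 : θ ≤ Lam := pucciWeight_le h q
  have hθ0 : 0 < θ := by linarith
  set T := pucciWeight lam Lam p
  have h3 : lam ≤ T := le_pucciWeight h p
  have h4 : T ≤ Lam := pucciWeight_le h p
  have e : x * q = -(x * y / θ) + D * (T / θ) * (-(x * p)) := by
    have : θ * q = -(D * (T * p)) - y := by linarith
    field_simp
    linear_combination x * this
  have i1 : x * y / Lam ≤ x * y / θ := div_le_div_of_nonneg_left hxy hθ0 h2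
  have i2 : T / θ ≤ Lam / lam := div_le_div₀ hLam.le h4 hlam h1
  have i3 : 0 ≤ T / θ := div_nonneg (by linarith) hθ0.le
  have i4 : D * (T / θ) * (-(x * p)) ≤ D * (Lam / lam) * |x * p| :=
    (mul_le_mul_of_nonneg_left (neg_le_abs (x * p)) (mul_nonneg hD i3)).trans
      (mul_le_mul_of_nonneg_right (mul_le_mul_of_nonneg_left i2 hD) (abs_nonneg _))
  linarith

lemma abs_second_deriv_le (hlam : 0 < lam) (h : lam ≤ Lam) {D p q y : ℝ} (hD : 0 ≤ D)
    (heq : pucciWeight lam Lam q * q + D * (pucciWeight lam Lam p * p) + y = 0) :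
    |q| ≤ (D * (Lam * |p|) + |y|) / lam := by
  rw [le_div_iff₀ hlam]
  have h1 := le_pucciWeight h q
  have h2 := pucciWeight_le h p
  have h3 := pucciWeight_pos hlam h p
  have h4 := pucciWeight_pos hlam h q
  calc |q| * lam ≤ |q| * pucciWeight lam Lam q := mul_le_mul_of_nonneg_left h1 (abs_nonneg _)
    _ = |pucciWeight lam Lam q * q| := by rw [abs_mul, abs_of_pos h4, mul_comm]
    _ = |D * (pucciWeight lam Lam p * p) + y| := by
      rw [← abs_neg]; congr 1; linarith
    _ ≤ |D * (pucciWeight lam Lam p * p)| + |y| := abs_add_le _ _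
    _ = D * (pucciWeight lam Lam p * |p|) + |y| := by
      rw [abs_mul, abs_mul, abs_of_pos h3, abs_of_nonneg hD]
    _ ≤ D * (Lam * |p|) + |y| := by gcongr

end Pointwise

section Potential

variable {lam Lam : ℝ} {g : ℝ → ℝ}

lemma continuous_pucciForce (hg : Continuous g) (h0 : g 0 = 0) :
    Continuous (pucciForce lam Lam g) := by
  unfold pucciForce
  refine Continuous.if_le (by fun_prop) (by fun_prop) continuous_const continuous_id ?_
  rintro x rfl; simp [h0]

lemma hasDerivAt_pucciPotential (hg : Continuous g) (h0 : g 0 = 0) (t : ℝ) :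
    HasDerivAt (pucciPotential lam Lam g) (pucciForce lam Lam g t) t :=
  (continuous_pucciForce hg h0).integral_hasStrictDerivAt 0 t |>.hasDerivAt

lemma continuous_pucciPotential (hg : Continuous g) (h0 : g 0 = 0) :
    Continuous (pucciPotential lam Lam g) :=
  continuous_iff_continuousAt.2 fun t => (hasDerivAt_pucciPotential hg h0 t).continuousAt

lemma pucciPotential_zero : pucciPotential lam Lam g 0 = 0 := by simp [pucciPotential]

variable {α : ℝ}

lemma strictMonoOn_pucciPotential (hlam : 0 < lam) (hg : Continuous g)
    (h0 : g 0 = 0) (hpos : ∀ t, 0 < t → t < α → 0 < g t) :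
    StrictMonoOn (pucciPotential lam Lam g) (Icc 0 α) := by
  refine strictMonoOn_of_hasDerivWithinAt_pos (convex_Icc _ _)
    (continuous_pucciPotential hg h0).continuousOn
    (fun t _ => (hasDerivAt_pucciPotential hg h0 t).hasDerivWithinAt) ?_
  rw [interior_Icc]
  intro t ht
  rw [pucciForce, if_pos ht.1.le]
  exact div_pos (hpos t ht.1 ht.2) hlam

lemma strictAntiOn_pucciPotential (hLam : 0 < Lam) (hg : Continuous g)
    (h0 : g 0 = 0) (hneg : ∀ t, -α < t → t < 0 → g t < 0) :
    StrictAntiOn (pucciPotential lam Lam g) (Icc (-α) 0) := by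
  refine strictAntiOn_of_hasDerivWithinAt_neg (convex_Icc _ _)
    (continuous_pucciPotential hg h0).continuousOn
    (fun t _ => (hasDerivAt_pucciPotential hg h0 t).hasDerivWithinAt) ?_
  rw [interior_Icc]
  intro t ht
  rw [pucciForce, if_neg (not_le.2 ht.2)]
  exact div_neg_of_neg_of_pos (hneg t ht.1 ht.2) hLam

lemma pucciPotential_pos (hlam : 0 < lam) (hLam : 0 < Lam) (hg : Continuous g)
    (h0 : g 0 = 0) (hpos : ∀ t, 0 < t → t < α → 0 < g t)
    (hneg : ∀ t, -α < t → t < 0 → g t < 0) {t : ℝ} (ht : |t| < α) (ht0 : t ≠ 0) :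
    0 < pucciPotential lam Lam g t := by
  rw [abs_lt] at ht
  rw [← pucciPotential_zero (lam := lam) (Lam := Lam) (g := g)]
  rcases lt_or_gt_of_ne ht0 with h | h
  · exact strictAntiOn_pucciPotential hLam hg h0 hneg ⟨ht.1.le, h.le⟩ ⟨by linarith, le_rfl⟩ h
  · exact strictMonoOn_pucciPotential hlam hg h0 hpos ⟨le_rfl, by linarith⟩ ⟨h.le, ht.2.le⟩ h

/-- The right well of the potential is at least as steep as the left one. -/
lemma pucciPotential_neg_le (hlam : 0 < lam) (h : lam ≤ Lam) (hg : Continuous g)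
    (hodd : ∀ t, g (-t) = -g t) (h0 : g 0 = 0) (hpos : ∀ t, 0 < t → t < α → 0 < g t)
    {t : ℝ} (ht0 : 0 ≤ t) (ht : t ≤ α) :
    pucciPotential lam Lam g (-t) ≤ pucciPotential lam Lam g t := by
  have hd : ∀ s, HasDerivAt
      (fun s => pucciPotential lam Lam g s - pucciPotential lam Lam g (-s))
      (pucciForce lam Lam g s - pucciForce lam Lam g (-s) * (-1)) s := fun s =>
    (hasDerivAt_pucciPotential hg h0 s).sub
      ((hasDerivAt_pucciPotential hg h0 (-s)).comp s (hasDerivAt_neg s))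
  have hm := monotoneOn_of_hasDerivWithinAt_nonneg (convex_Icc 0 α)
    (fun s _ => (hd s).continuousAt.continuousWithinAt)
    (fun s _ => (hd s).hasDerivWithinAt) (by
      rw [interior_Icc]
      intro s hs
      rw [pucciForce, pucciForce, if_pos hs.1.le, if_neg (by linarith [hs.1]), hodd]
      have := div_le_div_of_nonneg_left (hpos s hs.1 hs.2).le hlam h
      rw [neg_div]; linarith)
  have := hm ⟨le_rfl, ht0.trans ht⟩ ⟨ht0, ht⟩ ht0
  simp only [neg_zero, sub_self] at this
  linarith

lemma abs_le_of_pucciPotential_le (hlam : 0 < lam) (h : lam ≤ Lam) (hg : Continuous g)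
    (hodd : ∀ t, g (-t) = -g t) (h0 : g 0 = 0) (hpos : ∀ t, 0 < t → t < α → 0 < g t)
    (hneg : ∀ t, -α < t → t < 0 → g t < 0) {ξ t : ℝ} (hξα : -α < ξ) (hξ0 : ξ < 0)
    (ht : |t| < α) (hle : pucciPotential lam Lam g t ≤ pucciPotential lam Lam g ξ) :
    |t| ≤ -ξ := by
  have hanti := strictAntiOn_pucciPotential (lam := lam) (hlam.trans_le h) hg h0 hneg
  have key : pucciPotential lam Lam g (-|t|) ≤ pucciPotential lam Lam g ξ := by
    rcases le_or_gt 0 t with h' | h'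
    · rw [abs_of_nonneg h'] at ht ⊢
      exact (pucciPotential_neg_le hlam h hg hodd h0 hpos h' ht.le).trans hle
    · rwa [abs_of_neg h', neg_neg]
  have := (hanti.le_iff_ge ⟨by linarith, by linarith [abs_nonneg t]⟩ ⟨hξα.le, hξ0.le⟩).1 key
  linarith

end Potential

/-- The energy of a radial solution. -/
noncomputable def pucciEnergy (lam Lam : ℝ) (g u p : ℝ → ℝ) (r : ℝ) : ℝ :=
  p r ^ 2 / 2 + pucciPotential lam Lam g (u r)

section Energy

variable {lam Lam n α : ℝ} {g u p q : ℝ → ℝ}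

lemma IsRadialSol.mono {I J : Set ℝ} (hs : IsRadialSol lam Lam n g u p q I) (h : J ⊆ I) :
    IsRadialSol lam Lam n g u p q J :=
  ⟨fun r hr => hs.1 r (h hr), fun r hr => hs.2 r (h hr), fun r hr => hs.3 r (h hr)⟩

lemma IsRadialSol.hasDerivAt_energy {I : Set ℝ} (hs : IsRadialSol lam Lam n g u p q I)
    (hg : Continuous g) (h0 : g 0 = 0) {r : ℝ} (hr : r ∈ I) :
    HasDerivAt (pucciEnergy lam Lam g u p) (p r * (q r + pucciForce lam Lam g (u r))) r := by
  have h1 := ((hs.deriv_snd r hr).pow 2).div_const 2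
  have h2 := (hasDerivAt_pucciPotential (lam := lam) (Lam := Lam) hg h0 (u r)).comp r
    (hs.deriv_fst r hr)
  refine (h1.add h2).congr_deriv ?_
  norm_num; ring

lemma nonneg_of_restoring (h0 : g 0 = 0) (hpos : ∀ t, 0 < t → t < α → 0 < g t)
    {t : ℝ} (ht : |t| < α) (h : 0 ≤ t) : 0 ≤ g t := by
  rcases h.eq_or_lt with rfl | h
  · exact h0.ge
  · exact (hpos t h (abs_lt.1 ht).2).le

lemma mul_pos_of_restoring (hpos : ∀ t, 0 < t → t < α → 0 < g t)
    (hneg : ∀ t, -α < t → t < 0 → g t < 0) {t : ℝ} (ht : |t| < α) (h : t ≠ 0) :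
    0 < t * g t := by
  rw [abs_lt] at ht
  rcases lt_or_gt_of_ne h with h | h
  · exact mul_pos_of_neg_of_neg h (hneg t ht.1 h)
  · exact mul_pos h (hpos t h ht.2)

lemma mul_nonneg_of_restoring (hpos : ∀ t, 0 < t → t < α → 0 < g t)
    (hneg : ∀ t, -α < t → t < 0 → g t < 0) {t : ℝ} (ht : |t| < α) : 0 ≤ t * g t := by
  by_cases h : t = 0
  · simp [h]
  · exact (mul_pos_of_restoring hpos hneg ht h).le

lemma IsRadialSol.energy_deriv_le {I : Set ℝ} (hs : IsRadialSol lam Lam n g u p q I)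
    (hlam : 0 < lam) (h : lam ≤ Lam) (hn : 0 ≤ n) (h0 : g 0 = 0)
    (hpos : ∀ t, 0 < t → t < α → 0 < g t) (hneg : ∀ t, -α < t → t < 0 → g t < 0)
    {r : ℝ} (hr : r ∈ I) (hr0 : 0 < r) (hu : |u r| < α) :
    p r * (q r + pucciForce lam Lam g (u r)) ≤ -(n / r * (lam / Lam)) * p r ^ 2 :=
  dissipation hlam h (div_nonneg hn hr0.le) (nonneg_of_restoring h0 hpos hu)
    (fun h' => (hneg _ (abs_lt.1 hu).1 h').le) (hs.eqn r hr)

lemma IsRadialSol.antitoneOn_energy {D : Set ℝ} (hD : Convex ℝ D)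
    (hs : IsRadialSol lam Lam n g u p q (interior D))
    (huc : ContinuousOn u D) (hpc : ContinuousOn p D)
    (hlam : 0 < lam) (h : lam ≤ Lam) (hn : 0 ≤ n) (hg : Continuous g) (h0 : g 0 = 0)
    (hpos : ∀ t, 0 < t → t < α → 0 < g t) (hneg : ∀ t, -α < t → t < 0 → g t < 0)
    (hD0 : ∀ r ∈ interior D, 0 < r) (hu : ∀ r ∈ interior D, |u r| < α) :
    AntitoneOn (pucciEnergy lam Lam g u p) D := by
  refine antitoneOn_of_hasDerivWithinAt_nonpos hD
    (((hpc.pow 2).div_const 2).add ((continuous_pucciPotential hg h0).comp_continuousOn huc))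
    (fun r hr => (hs.hasDerivAt_energy hg h0 hr).hasDerivWithinAt) fun r hr => ?_
  refine (hs.energy_deriv_le hlam h hn h0 hpos hneg hr (hD0 r hr) (hu r hr)).trans ?_
  have := hD0 r hr
  have : 0 < Lam := hlam.trans_le h
  rw [neg_mul, neg_nonpos]
  positivity

/-- A solution starting at rest at `ξ ∈ (-α, 0)` stays in `[ξ, -ξ]`. -/
lemma IsRadialSol.abs_fst_le {T ξ : ℝ} (hs : IsRadialSol lam Lam n g u p q (Ioo 0 T))
    (huc : ContinuousOn u (Icc 0 T)) (hpc : ContinuousOn p (Icc 0 T))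
    (hlam : 0 < lam) (h : lam ≤ Lam) (hn : 0 ≤ n) (hg : Continuous g)
    (hodd : ∀ t, g (-t) = -g t) (h0 : g 0 = 0)
    (hpos : ∀ t, 0 < t → t < α → 0 < g t) (hneg : ∀ t, -α < t → t < 0 → g t < 0)
    (hξα : -α < ξ) (hξ0 : ξ < 0) (hu0 : u 0 = ξ) (hp0 : p 0 = 0) :
    ∀ r ∈ Icc 0 T, |u r| ≤ -ξ := by
  by_contra! hcon
  obtain ⟨r₁, hr₁, hlt⟩ := hcon
  obtain ⟨b, hb1, hb2⟩ := exists_between (lt_min hlt (show -ξ < α by linarith))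
  have hcont : ContinuousOn (fun r => |u r|) (Icc 0 r₁) :=
    (huc.mono (Icc_subset_Icc_right hr₁.2)).abs
  have hcomp : IsCompact (Icc 0 r₁ ∩ (fun r => |u r|) ⁻¹' Ici b) :=
    isCompact_Icc.of_isClosed_subset (hcont.preimage_isClosed_of_isClosed isClosed_Icc isClosed_Ici)
      inter_subset_left
  obtain ⟨r₂, ⟨hr₂, hbr⟩, hleast⟩ :=
    hcomp.exists_isLeast ⟨r₁, ⟨hr₁.1, le_rfl⟩, (hb2.trans_le (min_le_left _ _)).le⟩
  have hbr : b ≤ |u r₂| := hbr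
  have hbefore : ∀ r ∈ Ico 0 r₂, |u r| < b := by
    intro r hr
    by_contra hc
    exact absurd (hleast ⟨⟨hr.1, hr.2.le.trans hr₂.2⟩, not_lt.1 hc⟩) (not_le.2 hr.2)
  have hbα : b < α := hb2.trans_le (min_le_right _ _)
  have hr₂0 : 0 < r₂ := by
    rcases hr₂.1.eq_or_lt with h' | h'
    · rw [← h', hu0, abs_of_neg hξ0] at hbr; linarith
    · exact h'
  have hr₂T : r₂ ≤ T := hr₂.2.trans hr₁.2
  have hanti : AntitoneOn (pucciEnergy lam Lam g u p) (Icc 0 r₂) := by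
    refine IsRadialSol.antitoneOn_energy (q := q) (convex_Icc _ _) ?_
      (huc.mono (Icc_subset_Icc_right hr₂T)) (hpc.mono (Icc_subset_Icc_right hr₂T))
      hlam h hn hg h0 hpos hneg ?_ ?_
    · rw [interior_Icc]; exact hs.mono (Ioo_subset_Ioo_right hr₂T)
    · rw [interior_Icc]; exact fun r hr => hr.1
    · rw [interior_Icc]; exact fun r hr => (hbefore r ⟨hr.1.le, hr.2⟩).trans hbα
  have hle : |u r₂| ≤ b := by
    have hc : ContinuousWithinAt (fun r => |u r|) (Ico 0 r₂) r₂ :=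
      (hcont r₂ hr₂).mono fun r hr => ⟨hr.1, hr.2.le.trans hr₂.2⟩
    refine hc.closure_le (by rw [closure_Ico hr₂0.ne]; exact ⟨hr₂0.le, le_rfl⟩)
      continuousWithinAt_const fun r hr => (hbefore r hr).le
  have hE := hanti ⟨le_rfl, hr₂0.le⟩ ⟨hr₂0.le, le_rfl⟩ hr₂0.le
  simp only [pucciEnergy, hu0, hp0] at hE
  have := abs_le_of_pucciPotential_le hlam h hg hodd h0 hpos hneg hξα hξ0
    (hle.trans_lt hbα) (by nlinarith [sq_nonneg (p r₂)])
  linarith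

lemma IsRadialSol.sq_snd_le {T ξ : ℝ} (hs : IsRadialSol lam Lam n g u p q (Ioo 0 T))
    (huc : ContinuousOn u (Icc 0 T)) (hpc : ContinuousOn p (Icc 0 T))
    (hlam : 0 < lam) (h : lam ≤ Lam) (hn : 0 ≤ n) (hg : Continuous g)
    (hodd : ∀ t, g (-t) = -g t) (h0 : g 0 = 0)
    (hpos : ∀ t, 0 < t → t < α → 0 < g t) (hneg : ∀ t, -α < t → t < 0 → g t < 0)
    (hξα : -α < ξ) (hξ0 : ξ < 0) (hu0 : u 0 = ξ) (hp0 : p 0 = 0) :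
    ∀ r ∈ Icc 0 T, p r ^ 2 ≤ 2 * pucciPotential lam Lam g ξ := by
  have hb := hs.abs_fst_le huc hpc hlam h hn hg hodd h0 hpos hneg hξα hξ0 hu0 hp0
  have hanti : AntitoneOn (pucciEnergy lam Lam g u p) (Icc 0 T) := by
    refine IsRadialSol.antitoneOn_energy (q := q) (convex_Icc _ _) ?_ huc hpc
      hlam h hn hg h0 hpos hneg ?_ ?_
    · rwa [interior_Icc]
    · rw [interior_Icc]; exact fun r hr => hr.1
    · rw [interior_Icc]
      exact fun r hr => (hb r ⟨hr.1.le, hr.2.le⟩).trans_lt (by linarith)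
  intro r hr
  have hE := hanti ⟨le_rfl, hr.1.trans hr.2⟩ hr hr.1
  simp only [pucciEnergy, hu0, hp0] at hE
  have hH : 0 ≤ pucciPotential lam Lam g (u r) := by
    by_cases hur : u r = 0
    · rw [hur, pucciPotential_zero]
    · exact (pucciPotential_pos hlam (hlam.trans_le h) hg h0 hpos hneg
        ((hb r hr).trans_lt (by linarith)) hur).le
  nlinarith

end Energy

section Asymptotics

variable {lam Lam n α a P : ℝ} {g u p q : ℝ → ℝ}

/-- The energy of a global bounded solution cannot stay away from zero. -/
lemma IsRadialSol.exists_energy_lt (hs : IsRadialSol lam Lam n g u p q (Ioi 0))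
    (hlam : 0 < lam) (h : lam ≤ Lam) (hn : 0 < n) (hg : Continuous g) (h0 : g 0 = 0)
    (hpos : ∀ t, 0 < t → t < α → 0 < g t) (hneg : ∀ t, -α < t → t < 0 → g t < 0)
    (haα : a < α) (hu : ∀ r, 0 < r → |u r| ≤ a) (hp : ∀ r, 0 < r → |p r| ≤ P)
    {ε : ℝ} (hε : 0 < ε) : ∃ r, 1 ≤ r ∧ pucciEnergy lam Lam g u p r < ε := by
  by_contra! hcon
  have hLam : 0 < Lam := hlam.trans_le h
  have ha0 : 0 ≤ a := (abs_nonneg _).trans (hu 1 one_pos)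
  have hP0 : 0 ≤ P := (abs_nonneg _).trans (hp 1 one_pos)
  have hug : ∀ r, 0 < r → 0 ≤ u r * g (u r) := fun r hr =>
    mul_nonneg_of_restoring hpos hneg ((hu r hr).trans_lt haα)
  obtain ⟨δ, hδ, hδle⟩ : ∃ δ > 0, ∀ r, 1 ≤ r → δ ≤ p r ^ 2 + u r * g (u r) := by
    have hcl : IsClosed {z : ℝ × ℝ | ε ≤ z.2 ^ 2 / 2 + pucciPotential lam Lam g z.1} :=
      isClosed_le continuous_const (by
        have := continuous_pucciPotential (lam := lam) (Lam := Lam) hg h0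
        fun_prop)
    have hK := (isCompact_Icc (a := -a) (b := a)).prod (isCompact_Icc (a := -P) (b := P))
      |>.inter_right hcl
    obtain ⟨δ, hδ, hle⟩ := hK.exists_forall_le' (f := fun z : ℝ × ℝ => z.2 ^ 2 + z.1 * g z.1)
      (a := 0) (by fun_prop) (by
        rintro ⟨t, y⟩ ⟨⟨ht, -⟩, hE⟩
        simp only [mem_ofPred_eq] at hE ht ⊢
        have ht' : |t| < α := (abs_le.2 ht).trans_lt haα
        by_cases h' : t = 0
        · rw [h', pucciPotential_zero] at hE
          rw [h']; linarith
        · have := mul_pos_of_restoring hpos hneg ht' h'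
          positivity)
    refine ⟨δ, hδ, fun r hr => hle (u r, p r) ⟨⟨abs_le.1 (hu r ?_), abs_le.1 (hp r ?_)⟩, hcon r hr⟩⟩
    all_goals linarith
  have hup : ∀ r, 0 < r → |u r * p r| ≤ a * P := fun r hr => by
    rw [abs_mul]; exact mul_le_mul (hu r hr) (hp r hr) (abs_nonneg _) ha0
  set k := n * (lam / Lam) with hk
  have hk0 : 0 < k := mul_pos hn (div_pos hlam hLam)
  set κ := k / 2 with hκ
  have hκ0 : 0 < κ := half_pos hk0
  set c := min (k / 2) (κ / Lam) with hc
  have hc0 : 0 < c := lt_min hκ0 (div_pos hκ0 hLam)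
  set C := κ * (n * (Lam / lam) * (a * P) + a * P) with hC
  have hC0 : 0 ≤ C := by positivity
  have hderiv : ∀ r, 0 < r → HasDerivAt
      (fun r => pucciEnergy lam Lam g u p r + κ * (u r * p r / r) + c * δ * Real.log r + C / r)
      (p r * (q r + pucciForce lam Lam g (u r))
        + κ * (((p r * p r + u r * q r) * r - u r * p r * 1) / r ^ 2)
        + c * δ * r⁻¹ + (0 * r - C * 1) / r ^ 2) r := fun r hr =>
    ((((hs.hasDerivAt_energy hg h0 hr).add
      ((((hs.deriv_fst r hr).mul (hs.deriv_snd r hr)).div (hasDerivAt_id r) hr.ne').const_mul κ)).add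
      ((Real.hasDerivAt_log hr.ne').const_mul _))).add
      ((hasDerivAt_const r C).div (hasDerivAt_id r) hr.ne')
  have hanti := antitoneOn_of_hasDerivWithinAt_nonpos (convex_Ici (1 : ℝ))
    (fun r hr => (hderiv r (one_pos.trans_le hr)).continuousAt.continuousWithinAt)
    (fun r hr => (hderiv r (by rw [interior_Ici] at hr; exact one_pos.trans hr)).hasDerivWithinAt)
    (by
      rw [interior_Ici]
      intro r hr
      have hr1 : 1 < r := hr
      have hr0 : 0 < r := one_pos.trans hr
      have e1 := hs.energy_deriv_le hlam h hn.le h0 hpos hneg (Set.mem_Ioi.2 hr0) hr0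
        ((hu r hr0).trans_lt haα)
      have e2 := mul_second_deriv_le hlam h (div_nonneg hn.le hr0.le) (hug r hr0)
        (hs.eqn r hr0)
      have e3 := hup r hr0
      have e4 := neg_le_abs (u r * p r)
      have e5 := hδle r hr1.le
      have e6 : c * (p r ^ 2 + u r * g (u r)) ≤ κ * p r ^ 2 + κ / Lam * (u r * g (u r)) := by
        have := min_le_left (k / 2) (κ / Lam)
        have := min_le_right (k / 2) (κ / Lam)
        nlinarith [sq_nonneg (p r), hug r hr0]
      have e7 : c * δ ≤ c * (p r ^ 2 + u r * g (u r)) := mul_le_mul_of_nonneg_left e5 hc0.le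
      have e8 : n / r * (Lam / lam) * |u r * p r| ≤ n / r * (Lam / lam) * (a * P) :=
        mul_le_mul_of_nonneg_left e3 (by positivity)
      have e9 : κ * (u r * q r) ≤
          κ * (-(u r * g (u r) / Lam) + n / r * (Lam / lam) * (a * P)) :=
        mul_le_mul_of_nonneg_left (by linarith) hκ0.le
      have e10 : -(κ * (u r * p r)) ≤ κ * (a * P) := by nlinarith
      have f1 : p r * (q r + pucciForce lam Lam g (u r)) ≤ -(k * p r ^ 2) / r := by
        refine e1.trans (le_of_eq ?_)
        rw [hk]; field_simp
      have f2 : κ * (((p r * p r + u r * q r) * r - u r * p r * 1) / r ^ 2) ≤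
          (κ * p r ^ 2 - κ / Lam * (u r * g (u r))) / r + C / r ^ 2 := by
        have : κ * (((p r * p r + u r * q r) * r - u r * p r * 1) / r ^ 2) =
          κ * p r ^ 2 / r + κ * (u r * q r) / r + -(κ * (u r * p r)) / r ^ 2 := by
          field_simp; ring
        rw [this]
        have g1 : κ * (u r * q r) / r ≤
          κ * (-(u r * g (u r) / Lam) + n / r * (Lam / lam) * (a * P)) / r :=
          div_le_div_of_nonneg_right e9 hr0.le
        have g2 : -(κ * (u r * p r)) / r ^ 2 ≤ κ * (a * P) / r ^ 2 :=
          div_le_div_of_nonneg_right e10 (by positivity)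
        refine (add_le_add (add_le_add le_rfl g1) g2).trans (le_of_eq ?_)
        rw [hC]; field_simp; ring
      have f3 : -(k * p r ^ 2) / r + (κ * p r ^ 2 - κ / Lam * (u r * g (u r))) / r
          + c * δ * r⁻¹ ≤ 0 := by
        rw [← div_eq_mul_inv, ← add_div, ← add_div]
        refine div_nonpos_of_nonpos_of_nonneg ?_ hr0.le
        have : k * p r ^ 2 = 2 * (κ * p r ^ 2) := by rw [hκ]; ring
        linarith
      have f4 : (0 * r - C * 1) / r ^ 2 = - (C / r ^ 2) := by ring
      linarith)
  have hlog : Tendsto (fun r => c * δ * Real.log r) atTop atTop :=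
    Real.tendsto_log_atTop.const_mul_atTop (mul_pos hc0 hδ)
  obtain ⟨r, hr1, hr2⟩ := ((eventually_ge_atTop (1 : ℝ)).and (hlog.eventually_gt_atTop
    (pucciEnergy lam Lam g u p 1 + κ * (u 1 * p 1 / 1) + c * δ * Real.log 1 + C / 1
      + κ * (a * P)))).exists
  have hr0 : 0 < r := by linarith
  have hle := hanti (mem_Ici.2 le_rfl) (mem_Ici.2 hr1) hr1
  simp only at hle
  have hE := hcon r hr1
  have : -(κ * (a * P)) ≤ κ * (u r * p r / r) := by
    have h1 : |u r * p r / r| ≤ a * P := by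
      rw [abs_div, abs_of_pos hr0]
      exact (div_le_self (abs_nonneg _) hr1).trans (hup r hr0)
    nlinarith [neg_abs_le (u r * p r / r)]
  have : 0 ≤ C / r := by positivity
  linarith

lemma IsRadialSol.tendsto_zero (hs : IsRadialSol lam Lam n g u p q (Ioi 0))
    (hlam : 0 < lam) (h : lam ≤ Lam) (hn : 0 < n) (hg : Continuous g) (h0 : g 0 = 0)
    (hpos : ∀ t, 0 < t → t < α → 0 < g t) (hneg : ∀ t, -α < t → t < 0 → g t < 0)
    (haα : a < α) (hu : ∀ r, 0 < r → |u r| ≤ a) (hp : ∀ r, 0 < r → |p r| ≤ P) :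
    Tendsto u atTop (𝓝 0) ∧ Tendsto p atTop (𝓝 0) ∧ Tendsto q atTop (𝓝 0) := by
  have hLam : 0 < Lam := hlam.trans_le h
  have hanti : AntitoneOn (pucciEnergy lam Lam g u p) (Ici 1) := by
    have hsub : Ici (1 : ℝ) ⊆ Ioi 0 := fun r hr =>
      mem_Ioi.2 (one_pos.trans_le hr)
    refine IsRadialSol.antitoneOn_energy (q := q) (convex_Ici _)
      (hs.mono (interior_subset.trans hsub))
      (fun r hr => (hs.deriv_fst r (hsub hr)).continuousAt.continuousWithinAt)
      (fun r hr => (hs.deriv_snd r (hsub hr)).continuousAt.continuousWithinAt)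
      hlam h hn.le hg h0 hpos hneg ?_ ?_
    · exact fun r hr => hsub (interior_subset hr)
    · exact fun r hr => (hu r (hsub (interior_subset hr))).trans_lt haα
  have hH : ∀ t, |t| ≤ a → 0 ≤ pucciPotential lam Lam g t := fun t ht => by
    by_cases h' : t = 0
    · rw [h', pucciPotential_zero]
    · exact (pucciPotential_pos hlam hLam hg h0 hpos hneg (ht.trans_lt haα) h').le
  have hE : ∀ ε > 0, ∀ᶠ r in atTop, pucciEnergy lam Lam g u p r < ε := by
    intro ε hε
    obtain ⟨r₀, hr₀, hlt⟩ := hs.exists_energy_lt hlam h hn hg h0 hpos hneg haα hu hp hε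
    filter_upwards [eventually_ge_atTop r₀] with r hr
    exact (hanti hr₀ (hr₀.trans hr) hr).trans_lt hlt
  have hut : Tendsto u atTop (𝓝 0) := by
    rw [Metric.tendsto_nhds]
    intro ε hε
    have hcomp : IsCompact (Icc (-a) a ∩ {t | ε ≤ |t|}) :=
      isCompact_Icc.inter_right (isClosed_le continuous_const continuous_abs)
    obtain ⟨m, hm, hle⟩ := hcomp.exists_forall_le' (a := 0)
      (continuous_pucciPotential (lam := lam) (Lam := Lam) hg h0).continuousOn
      fun t ht => pucciPotential_pos hlam hLam hg h0 hpos hneg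
        ((abs_le.2 ht.1).trans_lt haα) (abs_pos.1 (hε.trans_le ht.2))
    filter_upwards [hE m hm, eventually_gt_atTop 0] with r hr hr0
    rw [dist_zero_right, Real.norm_eq_abs]
    by_contra hc
    have := hle (u r) ⟨abs_le.1 (hu r hr0), not_lt.1 hc⟩
    rw [pucciEnergy] at hr
    nlinarith [sq_nonneg (p r)]
  have hpt : Tendsto p atTop (𝓝 0) := by
    rw [Metric.tendsto_nhds]
    intro ε hε
    filter_upwards [hE (ε ^ 2 / 2) (by positivity), eventually_gt_atTop 0] with r hr hr0
    rw [dist_zero_right, Real.norm_eq_abs]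
    rw [pucciEnergy] at hr
    exact abs_lt_of_sq_lt_sq (by linarith [hH (u r) (hu r hr0)]) hε.le
  refine ⟨hut, hpt, ?_⟩
  have hgu : Tendsto (fun r => g (u r)) atTop (𝓝 0) := by
    have := (hg.tendsto 0).comp hut
    rwa [h0] at this
  have hbound : Tendsto (fun r => (n / r * (Lam * |p r|) + |g (u r)|) / lam) atTop (𝓝 0) := by
    have h1 : Tendsto (fun r : ℝ => n / r) atTop (𝓝 0) := tendsto_const_nhds.div_atTop tendsto_id
    have h2 := ((h1.mul (hpt.abs.const_mul Lam)).add hgu.abs).div_const lam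
    simpa using h2
  refine squeeze_zero_norm' ?_ hbound
  filter_upwards [eventually_gt_atTop 0] with r hr
  exact abs_second_deriv_le hlam h (div_nonneg hn.le hr.le) (hs.eqn r hr)

/-- A solution decaying to zero oscillates, by a Riccati argument. -/
lemma IsRadialSol.exists_zero (hs : IsRadialSol lam Lam n g u p q (Ioi 0))
    (hlam : 0 < lam) (h : lam ≤ Lam) (hn : 0 ≤ n) (h0 : g 0 = 0)
    {g' : ℝ} (hg' : HasDerivAt g g' 0) (hg'pos : 0 < g') (hu : Tendsto u atTop (𝓝 0)) (M : ℝ) :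
    ∃ r, M ≤ r ∧ u r = 0 := by
  by_contra! hcon
  have hLam : 0 < Lam := hlam.trans_le h
  set m := g' / 2 with hm
  have hm0 : 0 < m := half_pos hg'pos
  have hnear : ∀ᶠ t in 𝓝 (0 : ℝ), m * t ^ 2 ≤ t * g t := by
    have := (hasDerivAt_iff_isLittleO.1 hg').def hm0
    filter_upwards [this] with t ht
    simp only [h0, sub_zero, smul_eq_mul, Real.norm_eq_abs] at ht
    have h1 : |t * (g t - t * g')| ≤ m * t ^ 2 := by
      rw [abs_mul, ← sq_abs]; nlinarith [abs_nonneg t]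
    nlinarith [neg_abs_le (t * (g t - t * g'))]
  set C := n * (Lam / lam) with hC
  set A := √(m / Lam) with hA
  have hA0 : 0 < A := Real.sqrt_pos.2 (div_pos hm0 hLam)
  have hA2 : A ^ 2 = m / Lam := Real.sq_sqrt (div_pos hm0 hLam).le
  have hCr : ∀ᶠ r : ℝ in atTop, C ^ 2 / r ^ 2 < m / Lam := by
    have : Tendsto (fun r : ℝ => C ^ 2 / r ^ 2) atTop (𝓝 0) :=
      tendsto_const_nhds.div_atTop (tendsto_pow_atTop two_ne_zero)
    exact this.eventually_lt_const (div_pos hm0 hLam)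
  obtain ⟨r₀, hr₀⟩ := eventually_atTop.1
    ((hu.eventually hnear).and (hCr.and ((eventually_ge_atTop M).and (eventually_gt_atTop 0))))
  have hderiv : ∀ r, r₀ ≤ r → HasDerivAt (fun r => Real.arctan (p r / u r / A) + A / 2 * r)
      (1 / (1 + (p r / u r / A) ^ 2) * ((q r * u r - p r * p r) / u r ^ 2 / A) + A / 2 * 1) r :=
    fun r hr => by
      obtain ⟨-, -, hMr, hr0⟩ := hr₀ r hr
      exact ((((hs.deriv_snd r hr0).div (hs.deriv_fst r hr0) (hcon r hMr)).div_const A).arctan).add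
        ((hasDerivAt_id r).const_mul _)
  have hanti := antitoneOn_of_hasDerivWithinAt_nonpos (convex_Ici r₀)
    (fun r hr => (hderiv r hr).continuousAt.continuousWithinAt)
    (fun r hr => (hderiv r (interior_subset hr)).hasDerivWithinAt)
    (by
      intro r hr
      obtain ⟨hgm, hCm, hMr, hr0⟩ := hr₀ r (interior_subset hr)
      have hur := hcon r hMr
      have hu2 : 0 < u r ^ 2 := by positivity
      have e := mul_second_deriv_le hlam h (div_nonneg hn hr0.le)
        (hgm.trans' (by positivity)) (hs.eqn r hr0)
      set w := p r / u r with hw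
      have hpw : p r = w * u r := by rw [hw]; field_simp
      have e1 : u r * q r ≤ -(m / Lam) * u r ^ 2 + C / r * |w| * u r ^ 2 := by
        have i1 : m * u r ^ 2 / Lam ≤ u r * g (u r) / Lam :=
          div_le_div_of_nonneg_right hgm hLam.le
        have i2 : |u r * p r| = |w| * u r ^ 2 := by
          rw [hpw, ← abs_of_pos hu2, ← abs_mul]; congr 1; ring
        rw [i2] at e
        have i3 : n / r * (Lam / lam) * (|w| * u r ^ 2) = C / r * |w| * u r ^ 2 := by
          rw [hC]; ring
        have i4 : m * u r ^ 2 / Lam = m / Lam * u r ^ 2 := by ring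
        linarith
      have e2 : C / r * |w| ≤ (m / Lam) / 2 + w ^ 2 / 2 := by
        have : (C / r) ^ 2 < m / Lam := by rwa [div_pow]
        nlinarith [sq_nonneg (C / r - |w|), sq_abs w]
      have e3 : (q r * u r - p r * p r) / u r ^ 2 ≤ -(A ^ 2 + w ^ 2) / 2 := by
        rw [div_le_iff₀ hu2, hA2, hpw]
        nlinarith [mul_le_mul_of_nonneg_right e2 hu2.le]
      have e4 : 1 / (1 + (w / A) ^ 2) * ((q r * u r - p r * p r) / u r ^ 2 / A) ≤
          1 / (1 + (w / A) ^ 2) * (-(A ^ 2 + w ^ 2) / 2 / A) :=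
        mul_le_mul_of_nonneg_left (div_le_div_of_nonneg_right e3 hA0.le) (by positivity)
      have e5 : 1 / (1 + (w / A) ^ 2) * (-(A ^ 2 + w ^ 2) / 2 / A) = -(A / 2) := by
        field_simp
      linarith)
  obtain ⟨r, hr1, hr2⟩ := ((eventually_ge_atTop r₀).and
    ((tendsto_id.const_mul_atTop (half_pos hA0)).eventually_gt_atTop
      (Real.arctan (p r₀ / u r₀ / A) + A / 2 * r₀ + Real.pi / 2))).exists
  have := hanti (mem_Ici.2 le_rfl) (mem_Ici.2 hr1) hr1
  simp only [id] at this hr2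
  linarith [Real.neg_pi_div_two_lt_arctan (p r / u r / A)]

end Asymptotics

/-- Inverse of the increasing map `x ↦ pucciWeight lam Lam x * x`. -/
noncomputable def pucciInv (lam Lam s : ℝ) : ℝ := min (s / Lam) (s / lam)

/-- First-order system equivalent to the radial equation. -/
noncomputable def pucciField (lam Lam n : ℝ) (g : ℝ → ℝ) (r : ℝ) (z : ℝ × ℝ) : ℝ × ℝ :=
  (z.2, pucciInv lam Lam (-(n / r * max (Lam * z.2) (lam * z.2) + g z.1)))

section Extension

variable {lam Lam n : ℝ} {g : ℝ → ℝ}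

lemma pucciWeight_mul_pucciInv (hlam : 0 < lam) (h : lam ≤ Lam) (s : ℝ) :
    pucciWeight lam Lam (pucciInv lam Lam s) * pucciInv lam Lam s = s := by
  have hLam : 0 < Lam := hlam.trans_le h
  rcases le_or_gt 0 s with hs | hs
  · have : pucciInv lam Lam s = s / Lam := min_eq_left (div_le_div_of_nonneg_left hs hlam h)
    rw [this, pucciWeight, if_pos (div_nonneg hs hLam.le)]
    field_simp
  · have h1 : s / lam ≤ s / Lam := by
      rw [div_le_div_iff₀ hlam hLam]; nlinarith
    have : pucciInv lam Lam s = s / lam := min_eq_right h1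
    rw [this, pucciWeight, if_neg (not_le.2 (div_neg_of_neg_of_pos hs hlam))]
    field_simp

lemma eq_pucciInv (hlam : 0 < lam) (h : lam ≤ Lam) {q s : ℝ}
    (hq : pucciWeight lam Lam q * q = s) : q = pucciInv lam Lam s := by
  have hLam : 0 < Lam := hlam.trans_le h
  subst hq
  unfold pucciWeight pucciInv
  split_ifs with h0
  · rw [min_eq_left (div_le_div_of_nonneg_left (by positivity) hlam h)]; field_simp
  · have : lam * q / lam = q := by field_simp
    rw [this, min_eq_right]
    rw [le_div_iff₀ hLam]; nlinarith

lemma abs_pucciInv_sub_le (hlam : 0 < lam) (h : lam ≤ Lam) (s t : ℝ) :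
    |pucciInv lam Lam s - pucciInv lam Lam t| ≤ |s - t| / lam := by
  refine (abs_min_sub_min_le_max _ _ _ _).trans (max_le ?_ ?_)
  · rw [← sub_div, abs_div, abs_of_pos (hlam.trans_le h)]
    exact div_le_div_of_nonneg_left (abs_nonneg _) hlam h
  · rw [← sub_div, abs_div, abs_of_pos hlam]

lemma abs_max_mul_sub_le (hlam : 0 < lam) (h : lam ≤ Lam) (s t : ℝ) :
    |max (Lam * s) (lam * s) - max (Lam * t) (lam * t)| ≤ Lam * |s - t| := by
  refine (abs_max_sub_max_le_max _ _ _ _).trans (max_le ?_ ?_)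
  · rw [← mul_sub, abs_mul, abs_of_pos (hlam.trans_le h)]
  · rw [← mul_sub, abs_mul, abs_of_pos hlam]
    exact mul_le_mul_of_nonneg_right h (abs_nonneg _)

lemma lipschitzWith_pucciField (hlam : 0 < lam) (h : lam ≤ Lam) (hn : 0 ≤ n) {K : NNReal}
    (hg : LipschitzWith K g) {c r : ℝ} (hc : 0 < c) (hr : c ≤ r) :
    LipschitzWith (Real.toNNReal (max 1 ((n / c * Lam + K) / lam)))
      (pucciField lam Lam n g r) := by
  have hLam : 0 < Lam := hlam.trans_le h
  have hnr : n / r ≤ n / c := div_le_div_of_nonneg_left hn hc hr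
  refine LipschitzWith.of_dist_le' fun z w => ?_
  have h1 : |z.1 - w.1| ≤ dist z w := by
    rw [Prod.dist_eq, ← Real.dist_eq]; exact le_max_left _ _
  have h2 : |z.2 - w.2| ≤ dist z w := by
    rw [Prod.dist_eq, ← Real.dist_eq]; exact le_max_right _ _
  have hd : 0 ≤ dist z w := dist_nonneg
  rw [Prod.dist_eq (x := pucciField lam Lam n g r z)]
  refine max_le ?_ ?_
  · rw [Real.dist_eq]
    exact h2.trans (le_mul_of_one_le_left hd (le_max_left _ _))
  · rw [Real.dist_eq]
    have hgd : |g z.1 - g w.1| ≤ K * |z.1 - w.1| := by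
      simpa [Real.dist_eq] using hg.dist_le_mul z.1 w.1
    calc _ ≤ _ := abs_pucciInv_sub_le hlam h _ _
      _ ≤ (n / c * (Lam * dist z w) + K * dist z w) / lam := by
        refine div_le_div_of_nonneg_right ?_ hlam.le
        have e : -(n / r * max (Lam * z.2) (lam * z.2) + g z.1)
            - -(n / r * max (Lam * w.2) (lam * w.2) + g w.1) =
            -(n / r * (max (Lam * z.2) (lam * z.2) - max (Lam * w.2) (lam * w.2))
              + (g z.1 - g w.1)) := by ring
        rw [e, abs_neg]
        refine (abs_add_le _ _).trans (add_le_add ?_ ?_)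
        · rw [abs_mul, abs_of_nonneg (div_nonneg hn (hc.le.trans hr))]
          refine mul_le_mul hnr ((abs_max_mul_sub_le hlam h _ _).trans ?_) (abs_nonneg _)
            (div_nonneg hn hc.le)
          exact mul_le_mul_of_nonneg_left h2 hLam.le
        · exact hgd.trans (mul_le_mul_of_nonneg_left h1 K.2)
      _ = (n / c * Lam + K) / lam * dist z w := by ring
      _ ≤ _ := mul_le_mul_of_nonneg_right (le_max_right _ _) hd

lemma norm_pucciField_le (hlam : 0 < lam) (h : lam ≤ Lam) (hn : 0 ≤ n) {c r B Y : ℝ}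
    (hc : 0 < c) (hr : c ≤ r) {z : ℝ × ℝ} (hz : |z.2| ≤ Y) (hgz : |g z.1| ≤ B) :
    ‖pucciField lam Lam n g r z‖ ≤ max Y ((n / c * (Lam * Y) + B) / lam) := by
  have hLam : 0 < Lam := hlam.trans_le h
  have hnr : n / r ≤ n / c := div_le_div_of_nonneg_left hn hc hr
  rw [Prod.norm_def]
  refine max_le_max hz ?_
  have h1 := abs_pucciInv_sub_le hlam h (-(n / r * max (Lam * z.2) (lam * z.2) + g z.1)) 0
  have h2 : pucciInv lam Lam 0 = 0 := by simp [pucciInv]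
  have h3 := abs_max_mul_sub_le hlam h z.2 0
  simp only [h2, sub_zero, mul_zero, max_self] at h1 h3
  refine h1.trans (div_le_div_of_nonneg_right ?_ hlam.le)
  rw [abs_neg]
  refine (abs_add_le _ _).trans (add_le_add ?_ hgz)
  rw [abs_mul, abs_of_nonneg (div_nonneg hn (hc.le.trans hr))]
  exact mul_le_mul hnr (h3.trans (mul_le_mul_of_nonneg_left hz hLam.le)) (abs_nonneg _)
    (div_nonneg hn hc.le)

lemma continuousOn_pucciField_snd (hg : Continuous g) {v y : ℝ → ℝ} {I : Set ℝ}
    (hI : ∀ r ∈ I, r ≠ 0) (hv : ContinuousOn v I) (hy : ContinuousOn y I) :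
    ContinuousOn (fun r => (pucciField lam Lam n g r (v r, y r)).2) I := by
  have h1 : ContinuousOn (fun r : ℝ => n / r) I := continuousOn_const.div continuousOn_id hI
  have h2 : ContinuousOn (fun r => g (v r)) I := hg.comp_continuousOn hv
  have h3 : ContinuousOn (fun r => max (Lam * y r) (lam * y r)) I :=
    (continuousOn_const.mul hy).sup (continuousOn_const.mul hy)
  have h4 := ((h1.mul h3).add h2).neg
  exact (h4.div_const Lam).inf (h4.div_const lam)

/-- A bounded radial solution on `(0, b)` extends past `b`. -/
lemma IsRadialSol.exists_extension {α a P b : ℝ} {u p q : ℝ → ℝ}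
    (hlam : 0 < lam) (h : lam ≤ Lam) (hn : 0 ≤ n) (hg : LocallyLipschitz g) (hb : 0 < b)
    (hs : IsRadialSol lam Lam n g u p q (Ioo 0 b)) (haα : a < α)
    (hu : ∀ r ∈ Ioo 0 b, |u r| ≤ a) (hp : ∀ r ∈ Ioo 0 b, |p r| ≤ P) :
    ∃ (t₀ T : ℝ) (v y z : ℝ → ℝ), 0 < t₀ ∧ t₀ < b ∧ b < T ∧
      IsRadialSol lam Lam n g v y z (Ioo t₀ T) ∧ ContinuousOn z (Ioo t₀ T) ∧
      ∀ r ∈ Ioo t₀ b, v r = u r := by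
  have hLam : 0 < Lam := hlam.trans_le h
  have hmid : b / 2 ∈ Ioo 0 b := ⟨by linarith, by linarith⟩
  have ha0 : 0 ≤ a := (abs_nonneg _).trans (hu _ hmid)
  have hP0 : 0 ≤ P := (abs_nonneg _).trans (hp _ hmid)
  obtain ⟨K, hK⟩ := (hg.locallyLipschitzOn (s := Icc (-α) α)).exists_lipschitzOnWith_of_compact
    isCompact_Icc
  obtain ⟨G, hG, hgG⟩ := hK.extend_real
  have hGeq : ∀ t, |t| < α → g t = G t := fun t ht => hgG ⟨(abs_lt.1 ht).1.le, (abs_lt.1 ht).2.le⟩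
  set c := b / 2 with hc
  have hc0 : 0 < c := half_pos hb
  set B := |G 0| + K * (a + 1) with hB
  have hGB : ∀ t, |t| ≤ a + 1 → |G t| ≤ B := fun t ht => by
    have h1 : |G t - G 0| ≤ K * |t| := by simpa [Real.dist_eq] using hG.dist_le_mul t 0
    have h2 : (K : ℝ) * |t| ≤ K * (a + 1) := mul_le_mul_of_nonneg_left ht K.2
    have h3 := abs_sub_abs_le_abs_sub (G t) (G 0)
    linarith
  set L := max (P + 1) ((n / c * (Lam * (P + 1)) + B) / lam) with hL
  have hL0 : 0 < L := lt_max_of_lt_left (by linarith)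
  set δ := 1 / L with hδ
  have hδ0 : 0 < δ := one_div_pos.2 hL0
  set t₀ := max c (b - δ / 2) with ht₀
  have ht₀b : t₀ < b := max_lt hmid.2 (by linarith)
  have hct₀ : c ≤ t₀ := le_max_left _ _
  have ht₀0 : 0 < t₀ := hc0.trans_le hct₀
  have hbT : b < t₀ + δ := by linarith [le_max_right c (b - δ / 2)]
  have hpos : ∀ r ∈ Icc t₀ (t₀ + δ), c ≤ r := fun r hr => hct₀.trans hr.1
  set x₀ : ℝ × ℝ := (u t₀, p t₀) with hx₀
  have hPL : IsPicardLindelof (pucciField lam Lam n G) (tmin := t₀) (tmax := t₀ + δ)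
      ⟨t₀, le_rfl, by linarith⟩ x₀ 1 0 (Real.toNNReal L)
      (Real.toNNReal (max 1 ((n / c * Lam + K) / lam))) := by
    refine ⟨fun r hr => (lipschitzWith_pucciField hlam h hn hG hc0 (hpos r hr)).lipschitzOnWith,
      fun x _ => ?_, fun r hr x hx => ?_, ?_⟩
    · exact continuousOn_const.prodMk (continuousOn_pucciField_snd (v := fun _ => x.1)
        (y := fun _ => x.2) hG.continuous (fun r hr => (hc0.trans_le (hpos r hr)).ne')
        continuousOn_const continuousOn_const)
    · rw [Real.coe_toNNReal _ hL0.le]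
      rw [Metric.mem_closedBall, Prod.dist_eq, max_le_iff, Real.dist_eq, Real.dist_eq] at hx
      have hxu := hu t₀ ⟨ht₀0, ht₀b⟩
      have hxp := hp t₀ ⟨ht₀0, ht₀b⟩
      obtain ⟨hx1, hx2⟩ := hx
      simp only [hx₀, NNReal.coe_one] at hx1 hx2
      refine norm_pucciField_le hlam h hn hc0 (hpos r hr) ?_ (hGB _ ?_)
      · linarith [abs_sub_abs_le_abs_sub x.2 (p t₀)]
      · linarith [abs_sub_abs_le_abs_sub x.1 (u t₀)]
    · rw [Real.coe_toNNReal _ hL0.le]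
      simp only [add_sub_cancel_left, sub_self, NNReal.coe_one, NNReal.coe_zero, sub_zero]
      rw [max_eq_left hδ0.le, hδ, mul_one_div, div_self hL0.ne']
  obtain ⟨f, hf0, hf⟩ := hPL.exists_eq_forall_mem_Icc_hasDerivWithinAt₀
  have hfc : ContinuousOn f (Icc t₀ (t₀ + δ)) := fun r hr => (hf r hr).continuousWithinAt
  have hfd : ∀ r ∈ Ioo t₀ (t₀ + δ), HasDerivAt f (pucciField lam Lam n G r (f r)) r :=
    fun r hr => (hf r ⟨hr.1.le, hr.2.le⟩).hasDerivAt (Icc_mem_nhds hr.1 hr.2)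
  have hsd : ∀ r ∈ Ioo 0 b,
      HasDerivAt (fun r => (u r, p r)) (pucciField lam Lam n G r (u r, p r)) r := by
    intro r hr
    refine ((hs.deriv_fst r hr).prodMk (hs.deriv_snd r hr)).congr_deriv ?_
    refine Prod.ext rfl (eq_pucciInv hlam h ?_)
    have := hs.eqn r hr
    rw [pucciWeight_mul_self h (p r), hGeq _ ((hu r hr).trans_lt haα)] at this
    simp only
    linarith
  have hagree : ∀ r ∈ Ico t₀ b, f r = (u r, p r) := by
    intro r hr
    have hsub : Icc t₀ r ⊆ Ioo 0 b := fun s hs => ⟨ht₀0.trans_le hs.1, hs.2.trans_lt hr.2⟩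
    refine ODE_solution_unique_of_mem_Icc_right (s := fun _ => univ)
      (v := pucciField lam Lam n G) (f := f) (g := fun r => (u r, p r)) (a := t₀) (b := r)
      (fun s hs => (lipschitzWith_pucciField hlam h hn hG hc0 (hct₀.trans hs.1)).lipschitzOnWith)
      (hfc.mono (Icc_subset_Icc_right (hr.2.trans hbT).le)) (fun s hs => ?_)
      (fun _ _ => mem_univ _) (fun s hs => (hsd s (hsub hs)).continuousAt.continuousWithinAt)
      (fun s hs => (hsd s (hsub ⟨hs.1, hs.2.le⟩)).hasDerivWithinAt) (fun _ _ => mem_univ _) hf0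
      ⟨hr.1, le_rfl⟩
    refine (hf s ⟨hs.1, (hs.2.trans (hr.2.trans hbT)).le⟩).mono_of_mem_nhdsWithin ?_
    exact mem_of_superset (Icc_mem_nhdsGE (hs.2.trans (hr.2.trans hbT)))
      (Icc_subset_Icc_left hs.1)
  have hfb : ContinuousAt (fun r => |(f r).1|) b :=
    ((hfd b ⟨ht₀b, hbT⟩).continuousAt.fst).abs
  have hbα : |(f b).1| < α := by
    refine lt_of_le_of_lt ?_ haα
    refine ContinuousWithinAt.closure_le (f := fun r => |(f r).1|) (g := fun _ => a)
      (s := Ico t₀ b) (x := b) (by rw [closure_Ico ht₀b.ne]; exact ⟨ht₀b.le, le_rfl⟩)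
      hfb.continuousWithinAt continuousWithinAt_const fun r hr => ?_
    simp only [hagree r hr]
    exact hu r ⟨ht₀0.trans_le hr.1, hr.2⟩
  obtain ⟨ε, hε, hball⟩ := Metric.eventually_nhds_iff.1 (hfb.eventually_lt_const hbα)
  have hsmall : ∀ r ∈ Ioo t₀ (min (t₀ + δ) (b + ε)), |(f r).1| < α := by
    intro r hr
    rcases lt_or_ge r b with hrb | hrb
    · rw [hagree r ⟨hr.1.le, hrb⟩]
      exact (hu r ⟨ht₀0.trans hr.1, hrb⟩).trans_lt haα
    · refine hball ?_
      rw [Real.dist_eq, abs_of_nonneg (by linarith)]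
      linarith [hr.2.trans_le (min_le_right _ _)]
  have hsub : Ioo t₀ (min (t₀ + δ) (b + ε)) ⊆ Ioo t₀ (t₀ + δ) :=
    Ioo_subset_Ioo_right (min_le_left _ _)
  refine ⟨t₀, min (t₀ + δ) (b + ε), fun r => (f r).1, fun r => (f r).2,
    fun r => (pucciField lam Lam n G r ((f r).1, (f r).2)).2, ht₀0, ht₀b,
    lt_min hbT (by linarith), ⟨fun r hr => (hfd r (hsub hr)).fst, fun r hr => (hfd r (hsub hr)).snd,
      fun r hr => ?_⟩, ?_, fun r hr => by simp only [hagree r ⟨hr.1.le, hr.2⟩]⟩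
  · simp only [pucciField]
    rw [pucciWeight_mul_pucciInv hlam h, pucciWeight_mul_self h, hGeq _ (hsmall r hr)]
    ring
  · exact continuousOn_pucciField_snd hG.continuous (fun r hr => (ht₀0.trans hr.1).ne')
      (fun r hr => (hfd r (hsub hr)).continuousAt.fst.continuousWithinAt)
      (fun r hr => (hfd r (hsub hr)).continuousAt.snd.continuousWithinAt)

end Extension

lemma ContDiffOn.exists_second_deriv {u : ℝ → ℝ} {S : Set ℝ} (hS : UniqueDiffOn ℝ S)
    (hu : ContDiffOn ℝ 2 u S) : ∃ p q : ℝ → ℝ, ContinuousOn p S ∧ ContinuousOn q S ∧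
      ∀ r, S ∈ 𝓝 r → HasDerivAt u (p r) r ∧ HasDerivAt p (q r) r ∧ deriv u =ᶠ[𝓝 r] p := by
  have hp : ContDiffOn ℝ 1 (derivWithin u S) S := hu.derivWithin hS (by norm_num)
  refine ⟨derivWithin u S, derivWithin (derivWithin u S) S, hp.continuousOn,
    hp.continuousOn_derivWithin hS le_rfl, fun r hr => ?_⟩
  have hr' : r ∈ S := mem_of_mem_nhds hr
  refine ⟨((hu.differentiableOn (by norm_num)) r hr').hasDerivWithinAt.hasDerivAt hr,
    ((hp.differentiableOn (by norm_num)) r hr').hasDerivWithinAt.hasDerivAt hr, ?_⟩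
  filter_upwards [eventually_mem_nhds_iff.2 hr] with s hs
  exact (derivWithin_of_mem_nhds hs).symm

lemma uniqueDiffOn_setOf_coe_lt {R : EReal} (hR : 0 < R) :
    UniqueDiffOn ℝ {r : ℝ | 0 ≤ r ∧ (r : EReal) < R} := by
  obtain ⟨c, hc0, hcR⟩ := EReal.lt_iff_exists_real_btwn.1 hR
  have hc0' : 0 < c := EReal.coe_pos.1 hc0
  refine uniqueDiffOn_convex ?_ ⟨c / 2, mem_interior_iff_mem_nhds.2 ?_⟩
  · refine OrdConnected.convex ⟨fun x hx y hy z hz => ⟨hx.1.trans hz.1, ?_⟩⟩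
    exact (EReal.coe_le_coe_iff.2 hz.2).trans_lt hy.2
  · refine mem_of_superset (Ioo_mem_nhds (half_pos hc0') (half_lt_self hc0')) fun r hr => ?_
    exact ⟨hr.1.le, (EReal.coe_lt_coe_iff.2 hr.2).trans hcR⟩

lemma setOf_coe_lt_mem_nhds {R : EReal} {r : ℝ} (h0 : 0 < r) (hr : (r : EReal) < R) :
    {r : ℝ | 0 ≤ r ∧ (r : EReal) < R} ∈ 𝓝 r := by
  obtain ⟨c, hrc, hcR⟩ := EReal.lt_iff_exists_real_btwn.1 hr
  refine mem_of_superset (Ioo_mem_nhds h0 (EReal.coe_lt_coe_iff.1 hrc)) fun s hs => ?_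
  exact ⟨hs.1.le, (EReal.coe_lt_coe_iff.2 hs.2).trans hcR⟩

/-- A radial solution with second derivative bounded up to the origin has vanishing slope there. -/
lemma IsRadialSol.snd_eq_zero {lam Lam n T : ℝ} {g u p q : ℝ → ℝ}
    (hlam : 0 < lam) (h : lam ≤ Lam) (hn : 1 ≤ n) (hg : Continuous g) (hT : 0 < T)
    (hs : IsRadialSol lam Lam n g u p q (Ioo 0 T)) (huc : ContinuousOn u (Icc 0 T))
    (hpc : ContinuousOn p (Icc 0 T)) (hqc : ContinuousOn q (Icc 0 T)) : p 0 = 0 := by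
  have hLam : 0 < Lam := hlam.trans_le h
  obtain ⟨C, hC⟩ := isCompact_Icc.exists_bound_of_continuousOn hqc
  obtain ⟨D, hD⟩ := isCompact_Icc.exists_bound_of_continuousOn (hg.comp_continuousOn huc)
  have hle : ∀ r ∈ Ioo 0 T, |p r| ≤ r * ((Lam * C + D) / lam) := by
    intro r hr
    have hr0 := hr.1
    have hrI : r ∈ Icc 0 T := ⟨hr.1.le, hr.2.le⟩
    have hw := le_pucciWeight h (p r)
    have hw' := pucciWeight_le h (q r)
    have hw0 := pucciWeight_pos hlam h (p r)
    have hw0' := pucciWeight_pos hlam h (q r)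
    have hq : |q r| ≤ C := hC r hrI
    have hgu : |g (u r)| ≤ D := hD r hrI
    have heq := hs.eqn r hr
    have hprod : n / r * (pucciWeight lam Lam (p r) * p r)
        = -(pucciWeight lam Lam (q r) * q r + g (u r)) := by linarith
    have habs : n / r * (pucciWeight lam Lam (p r) * |p r|) ≤ Lam * C + D := by
      have e := congrArg abs hprod
      rw [abs_neg, abs_mul, abs_mul, abs_of_pos hw0, abs_of_nonneg (by positivity)] at e
      rw [e]
      refine (abs_add_le _ _).trans (add_le_add ?_ hgu)
      rw [abs_mul, abs_of_pos hw0']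
      exact mul_le_mul hw' hq (abs_nonneg _) hLam.le
    have h1 : 1 / r * (lam * |p r|) ≤ n / r * (pucciWeight lam Lam (p r) * |p r|) := by
      gcongr
    have h2 : |p r| = r * ((1 / r * (lam * |p r|)) / lam) := by field_simp
    rw [h2]
    gcongr
    exact h1.trans habs
  have h0 : |p 0| ≤ 0 * ((Lam * C + D) / lam) := by
    refine ContinuousWithinAt.closure_le (f := fun r => |p r|)
      (g := fun r => r * ((Lam * C + D) / lam)) (s := Ioo 0 T) (x := 0)
      (by rw [closure_Ioo hT.ne]; exact ⟨le_rfl, hT.le⟩) ?_ ?_ hle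
    · exact ((hpc 0 ⟨le_rfl, hT.le⟩).mono Ioo_subset_Icc_self).abs
    · exact (continuous_id.mul continuous_const).continuousWithinAt
  rw [zero_mul] at h0
  exact abs_nonpos_iff.1 h0

lemma contDiffOn_two_of_hasDerivAt {v y z : ℝ → ℝ} {s : Set ℝ} (hso : IsOpen s)
    (hv : ∀ r ∈ s, HasDerivAt v (y r) r) (hy : ∀ r ∈ s, HasDerivAt y (z r) r)
    (hz : ContinuousOn z s) : ContDiffOn ℝ 2 v s := by
  have h1 : ContDiffOn ℝ 1 y s := by
    rw [show (1 : WithTop ℕ∞) = 0 + 1 by norm_num, contDiffOn_succ_iff_deriv_of_isOpen hso]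
    refine ⟨fun r hr => (hy r hr).differentiableAt.differentiableWithinAt, by simp, ?_⟩
    exact contDiffOn_zero.2 (hz.congr fun r hr => (hy r hr).deriv)
  rw [show (2 : WithTop ℕ∞) = 1 + 1 by norm_num, contDiffOn_succ_iff_deriv_of_isOpen hso]
  exact ⟨fun r hr => (hv r hr).differentiableAt.differentiableWithinAt, by simp,
    h1.congr fun r hr => (hv r hr).deriv⟩

theorem pucci_radial_plus_oscillating_negative_data
    (lam Lam : ℝ) (hlam : 0 < lam) (hlamLam : lam ≤ Lam)
    (N : ℕ) (hN : 2 ≤ N)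
    (g : ℝ → ℝ) (hg1 : LocallyLipschitz g)
    (hg2 : ∀ t, g (-t) = - g t)
    (α : ℝ) (hα : 0 < α)
    (hg3pos : ∀ t, 0 < t → t < α → 0 < g t)
    (hg3neg : ∀ t, α < t → g t < 0)
    (g'0 : ℝ) (hg4 : HasDerivAt g g'0 0) (hg4pos : 0 < g'0)
    (ξ : ℝ) (hξα : -α < ξ) (hξ0 : ξ < 0)
    (R : EReal) (hR : 0 < R)
    (u : ℝ → ℝ)
    (hu : ContDiffOn ℝ 2 u {r : ℝ | 0 ≤ r ∧ (r : EReal) < R})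
    (hode : ∀ r : ℝ, 0 < r → (r : EReal) < R →
      (if 0 ≤ deriv (deriv u) r then Lam else lam) * deriv (deriv u) r
        + ((N : ℝ) - 1) / r * ((if 0 ≤ deriv u r then Lam else lam) * deriv u r)
        + g (u r) = 0)
    (hu0 : u 0 = ξ) (hu'0 : deriv u 0 = 0)
    (hmax : ¬ ∃ (R' : EReal) (v : ℝ → ℝ), R < R' ∧
      ContDiffOn ℝ 2 v {r : ℝ | 0 ≤ r ∧ (r : EReal) < R'} ∧
      (∀ r : ℝ, 0 < r → (r : EReal) < R' →
        (if 0 ≤ deriv (deriv v) r then Lam else lam) * deriv (deriv v) r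
        + ((N : ℝ) - 1) / r * ((if 0 ≤ deriv v r then Lam else lam) * deriv v r)
        + g (v r) = 0) ∧
      v 0 = ξ ∧ deriv v 0 = 0 ∧
      (∀ r : ℝ, 0 ≤ r → (r : EReal) < R → v r = u r))
 :
    R = ⊤ ∧
    (∀ M : ℝ, ∃ r, M ≤ r ∧ u r = 0) ∧
    Tendsto u atTop (𝓝 0) ∧ Tendsto (deriv u) atTop (𝓝 0) ∧
    Tendsto (deriv (deriv u)) atTop (𝓝 0) ∧
    sSup ((fun r => |u r|) '' Set.Ici 0) = -ξ ∧ -ξ < α := by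

  set S : Set ℝ := {r : ℝ | 0 ≤ r ∧ (r : EReal) < R} with hS
  have hn : (1 : ℝ) ≤ (N : ℝ) - 1 := by
    have : (2 : ℝ) ≤ N := by exact_mod_cast hN
    linarith
  have hn0 : (0 : ℝ) < (N : ℝ) - 1 := by linarith
  have hg0 : g 0 = 0 := by
    have := hg2 0
    rw [neg_zero] at this
    linarith
  have hg := hg1.continuous
  have hneg : ∀ t, -α < t → t < 0 → g t < 0 := fun t h1 h2 => by
    have := hg3pos (-t) (by linarith) (by linarith)
    rw [hg2] at this
    linarith
  obtain ⟨p, q, hpc, hqc, hpq⟩ := hu.exists_second_deriv (uniqueDiffOn_setOf_coe_lt hR)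
  have hderiv : ∀ r, S ∈ 𝓝 r → deriv u r = p r ∧ deriv (deriv u) r = q r := fun r hr =>
    ⟨(hpq r hr).2.2.eq_of_nhds, (hpq r hr).2.2.deriv_eq.trans (hpq r hr).2.1.deriv⟩
  have hsol : IsRadialSol lam Lam ((N : ℝ) - 1) g u p q {r : ℝ | 0 < r ∧ (r : EReal) < R} := by
    refine ⟨fun r hr => (hpq r (setOf_coe_lt_mem_nhds hr.1 hr.2)).1,
      fun r hr => (hpq r (setOf_coe_lt_mem_nhds hr.1 hr.2)).2.1, fun r hr => ?_⟩
    have h1 := hderiv r (setOf_coe_lt_mem_nhds hr.1 hr.2)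
    have h2 := hode r hr.1 hr.2
    rwa [h1.1, h1.2] at h2
  have hIoo : ∀ T : ℝ, (T : EReal) < R → Ioo 0 T ⊆ {r : ℝ | 0 < r ∧ (r : EReal) < R} :=
    fun T hT r hr => ⟨hr.1, (EReal.coe_lt_coe_iff.2 hr.2).trans hT⟩
  have hIcc : ∀ T : ℝ, (T : EReal) < R → Icc 0 T ⊆ S :=
    fun T hT r hr => ⟨hr.1, (EReal.coe_le_coe_iff.2 hr.2).trans_lt hT⟩
  have hp0 : p 0 = 0 := by
    obtain ⟨c, hc0, hcR⟩ := EReal.lt_iff_exists_real_btwn.1 hR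
    exact (hsol.mono (hIoo c hcR)).snd_eq_zero hlam hlamLam hn hg (EReal.coe_pos.1 hc0)
      (hu.continuousOn.mono (hIcc c hcR)) (hpc.mono (hIcc c hcR)) (hqc.mono (hIcc c hcR))
  set P := √(2 * pucciPotential lam Lam g ξ)
  have huξ : ∀ r ∈ S, |u r| ≤ -ξ := fun r hr =>
    (hsol.mono (hIoo r hr.2)).abs_fst_le (hu.continuousOn.mono (hIcc r hr.2))
      (hpc.mono (hIcc r hr.2)) hlam hlamLam hn0.le hg hg2 hg0 hg3pos hneg hξα hξ0 hu0 hp0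
      r ⟨hr.1, le_rfl⟩
  have hpP : ∀ r ∈ S, |p r| ≤ P := fun r hr =>
    Real.abs_le_sqrt <| (hsol.mono (hIoo r hr.2)).sq_snd_le
      (hu.continuousOn.mono (hIcc r hr.2)) (hpc.mono (hIcc r hr.2)) hlam hlamLam hn0.le hg hg2
      hg0 hg3pos hneg hξα hξ0 hu0 hp0 r ⟨hr.1, le_rfl⟩
  have hRtop : R = ⊤ := by
    by_contra hne
    obtain ⟨b, rfl⟩ : ∃ b : ℝ, (b : EReal) = R :=
      ⟨R.toReal, EReal.coe_toReal hne (ne_bot_of_gt hR)⟩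
    have hb : 0 < b := EReal.coe_pos.1 hR
    have hS' : Ioo 0 b ⊆ S := fun r hr => ⟨hr.1.le, EReal.coe_lt_coe_iff.2 hr.2⟩
    obtain ⟨t₀, T, v, y, z, ht₀, ht₀b, hbT, hv, hz, hvu⟩ :=
      (hsol.mono fun r hr => ⟨hr.1, EReal.coe_lt_coe_iff.2 hr.2⟩ :
        IsRadialSol lam Lam ((N : ℝ) - 1) g u p q (Ioo 0 b)).exists_extension hlam hlamLam hn0.le
        hg1 hb (by linarith : -ξ < α) (fun r hr => huξ r (hS' hr)) (fun r hr => hpP r (hS' hr))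
    set w : ℝ → ℝ := fun r => if r < b then u r else v r with hw
    have hwu : ∀ r, r < b → w =ᶠ[𝓝 r] u := fun r hr => by
      filter_upwards [Iio_mem_nhds hr] with s hs using if_pos hs
    have hwv : ∀ r ∈ Ioo t₀ T, w =ᶠ[𝓝 r] v := fun r hr => by
      filter_upwards [Ioo_mem_nhds hr.1 hr.2] with s hs
      simp only [hw]
      split_ifs with hsb
      · exact (hvu s ⟨hs.1, hsb⟩).symm
      · rfl
    refine hmax ⟨(T : EReal), w, EReal.coe_lt_coe_iff.2 hbT, fun r hr => ?_, fun r hr hrT => ?_,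
      ?_, ?_, fun r _ hr => if_pos (EReal.coe_lt_coe_iff.1 hr)⟩
    · rcases lt_or_ge r b with hrb | hrb
      · refine ContDiffWithinAt.congr_of_eventuallyEq ?_
          ((hwu r hrb).filter_mono nhdsWithin_le_nhds) (hwu r hrb).eq_of_nhds
        refine (hu r ⟨hr.1, EReal.coe_lt_coe_iff.2 hrb⟩).mono_of_mem_nhdsWithin ?_
        filter_upwards [self_mem_nhdsWithin, mem_nhdsWithin_of_mem_nhds (Iio_mem_nhds hrb)]
          with s hs hsb using ⟨hs.1, EReal.coe_lt_coe_iff.2 hsb⟩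
      · have hrI : r ∈ Ioo t₀ T := ⟨ht₀b.trans_le hrb, EReal.coe_lt_coe_iff.1 hr.2⟩
        have hv2 := contDiffOn_two_of_hasDerivAt isOpen_Ioo hv.deriv_fst hv.deriv_snd hz
        exact (((hv2.contDiffAt (Ioo_mem_nhds hrI.1 hrI.2))).congr_of_eventuallyEq
          (hwv r hrI)).contDiffWithinAt
    · rcases lt_or_ge r b with hrb | hrb
      · rw [(hwu r hrb).deriv.deriv_eq, (hwu r hrb).deriv_eq, (hwu r hrb).eq_of_nhds]
        exact hode r hr (EReal.coe_lt_coe_iff.2 hrb)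
      · have hrI : r ∈ Ioo t₀ T := ⟨ht₀b.trans_le hrb, EReal.coe_lt_coe_iff.1 hrT⟩
        have hvy : deriv v =ᶠ[𝓝 r] y := by
          filter_upwards [Ioo_mem_nhds hrI.1 hrI.2] with s hs using (hv.deriv_fst s hs).deriv
        rw [(hwv r hrI).deriv.deriv_eq, (hwv r hrI).deriv_eq, (hwv r hrI).eq_of_nhds,
          hvy.deriv_eq, hvy.eq_of_nhds, (hv.deriv_snd r hrI).deriv]
        exact hv.eqn r hrI
    · rw [(hwu 0 hb).eq_of_nhds, hu0]
    · rw [(hwu 0 hb).deriv_eq, hu'0]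
  subst hRtop
  have hmem : ∀ r : ℝ, 0 ≤ r → r ∈ S := fun r hr => ⟨hr, EReal.coe_lt_top r⟩
  have hsol' : IsRadialSol lam Lam ((N : ℝ) - 1) g u p q (Ioi 0) :=
    hsol.mono fun r hr => ⟨hr, EReal.coe_lt_top r⟩
  obtain ⟨hu_lim, hp_lim, hq_lim⟩ := hsol'.tendsto_zero hlam hlamLam hn0 hg hg0 hg3pos hneg
    (by linarith : -ξ < α) (fun r hr => huξ r (hmem r hr.le)) (fun r hr => hpP r (hmem r hr.le))
  have hderiv' : ∀ᶠ r in atTop, deriv u r = p r ∧ deriv (deriv u) r = q r := by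
    filter_upwards [eventually_gt_atTop 0] with r hr
    exact hderiv r (setOf_coe_lt_mem_nhds hr (EReal.coe_lt_top r))
  refine ⟨rfl, hsol'.exists_zero hlam hlamLam hn0.le hg0 hg4 hg4pos hu_lim, hu_lim,
    hp_lim.congr' (hderiv'.mono fun r hr => hr.1.symm),
    hq_lim.congr' (hderiv'.mono fun r hr => hr.2.symm), ?_, by linarith⟩
  refine IsGreatest.csSup_eq ⟨⟨0, self_mem_Ici, ?_⟩, ?_⟩
  · simp only [hu0, abs_of_neg hξ0]
  · rintro _ ⟨r, hr, rfl⟩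
    exact huξ r (hmem r hr)
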